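/- arXiv:1212.5768 — 4 statements merged into one kernel-verified Lean document; each statement's English description precedes it below -/
import Mathlib

section
/- Under the protocol, suppose at some time t > 1 with t ≥ 1 + (8 W(0))^{1/(β−α)} an edge (i,j) ∈ E(t) has q_{j→i}(t) ∈ {−1, 1}. Then the estimation error decreases: |x̂_{i,j,in}(t) − x_j(t−1)| ≤ |x̂_{i,j,in}(t−1) − x_j(t−2)| − (7/8)/t^α. Here W(0) = max_k x_k(0) − min_k x_k(0). -/
open scoped Classical

noncomputable section

/-- The rounding function `R` sending `x` to `1`, `0`, `-1` according to `x > 1`,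
`-1 ≤ x ≤ 1`, `x < -1`. -/
def Rq (y : ℝ) : ℝ := if y > 1 then 1 else if y < -1 then -1 else 0

/-- The data and evolution equations of the ternary-message average-consensus protocol
on `n` nodes.  `E t i j` means the edge `(i,j)` is present in the graph `G(t)`
(for `t ≥ 1`); `x t i` is the value of node `i` at time `t`; `xin t i j` is
`x̂_{i,j,in}(t)`, `xout t i j` is `x̂_{i,j,out}(t)` and `q t i j` is `q_{i→j}(t)`. -/
structure Protocol (n : ℕ) where
  α : ℝ
  β : ℝ
  hα : 0 < α
  hαβ : α < β
  hβ : β < 1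
  E : ℕ → Fin n → Fin n → Prop
  Esymm : ∀ t i j, E t i j → E t j i
  Eirrefl : ∀ t i, ¬ E t i i
  D : Fin n → Fin n → ℕ → ℝ
  Dsymm : ∀ i j t, D i j t = D j i t
  Dbound : ∀ t i j, E t i j →
    ((max (Set.ncard {k | E t i k}) (Set.ncard {k | E t j k}) : ℕ) : ℝ) ≤ D i j t
  x : ℕ → Fin n → ℝ
  xin : ℕ → Fin n → Fin n → ℝ
  xout : ℕ → Fin n → Fin n → ℝ
  q : ℕ → Fin n → Fin n → ℝ
  hxin0 : ∀ i j, xin 0 i j = 0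
  hxout0 : ∀ i j, xout 0 i j = 0
  hq : ∀ t, 1 ≤ t → ∀ i j, E t i j →
    q t i j = Rq ((t : ℝ) ^ α * (x (t - 1) i - xout (t - 1) i j))
  hxoutE : ∀ t, 1 ≤ t → ∀ i j, E t i j →
    xout t i j = xout (t - 1) i j + q t i j / (t : ℝ) ^ α
  hxinE : ∀ t, 1 ≤ t → ∀ i j, E t i j →
    xin t i j = xin (t - 1) i j + q t j i / (t : ℝ) ^ α
  hxoutN : ∀ t, 1 ≤ t → ∀ i j, ¬ E t i j → xout t i j = xout (t - 1) i j
  hxinN : ∀ t, 1 ≤ t → ∀ i j, ¬ E t i j → xin t i j = xin (t - 1) i j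
  hx : ∀ t, 1 ≤ t → ∀ i, x t i = x (t - 1) i + (1 / (t : ℝ) ^ β) *
    ∑ j ∈ Finset.univ.filter (fun j => E t i j ∧
        4 / (t : ℝ) ^ α < |xin t i j - xout t i j| ∧ q t j i = 0 ∧ q t i j = 0),
      (xin t i j - xout t i j) / (4 * D i j t)

namespace Protocol

variable {n : ℕ} (P : Protocol n)

/-- The set `S(i,t)` of neighbors that node `i` includes in its update at time `t`. -/
def S (t : ℕ) (i : Fin n) : Finset (Fin n) :=
  Finset.univ.filter (fun j => P.E t i j ∧
    4 / (t : ℝ) ^ P.α < |P.xin t i j - P.xout t i j| ∧ P.q t j i = 0 ∧ P.q t i j = 0)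

/-- The graph sequence of the protocol is `B`-core-connected with core edge
relation `Einf`: every core edge appears at some time, the graph of core edges is
connected, and every core edge appears in every time window `[kB+1, (k+1)B]`. -/
def CoreConnected (B : ℕ) (Einf : Fin n → Fin n → Prop) : Prop :=
  (∀ i j, Einf i j → ∃ t, 1 ≤ t ∧ P.E t i j) ∧
  (SimpleGraph.fromRel Einf).Connected ∧
  ∀ k : ℕ, ∀ i j, Einf i j → ∃ t, k * B + 1 ≤ t ∧ t ≤ (k + 1) * B ∧ P.E t i j

end Protocol

/-- `M(x)`: the largest coordinate. -/
def maxV {n : ℕ} (y : Fin n → ℝ) : ℝ := ⨆ i, y i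

/-- `m(x)`: the smallest coordinate. -/
def minV {n : ℕ} (y : Fin n → ℝ) : ℝ := ⨅ i, y i

/-- `W(x) = M(x) - m(x)`. -/
def Wsp {n : ℕ} (y : Fin n → ℝ) : ℝ := maxV y - minV y

/-- The sup norm `‖x‖_∞ = max_i |x_i|`. -/
def normInf {n : ℕ} (y : Fin n → ℝ) : ℝ := ⨆ i, |y i|

/-- `V2(x) = sqrt(Σ_i (x_i - (1/n) Σ_j x_j)²)`. -/
def V2 {n : ℕ} (y : Fin n → ℝ) : ℝ :=
  Real.sqrt (∑ i, (y i - (∑ j, y j) / n) ^ 2)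

theorem abs_le_one_of_Rq_eq_zero {y : ℝ} (h : Rq y = 0) : |y| ≤ 1 := by
  unfold Rq at h
  split_ifs at h with h1 h2
  · norm_num at h
  · norm_num at h
  · exact abs_le.2 ⟨not_lt.1 h2, not_lt.1 h1⟩

theorem one_lt_of_Rq_eq_one {y : ℝ} (h : Rq y = 1) : 1 < y := by
  unfold Rq at h
  split_ifs at h with h1 h2
  · exact h1
  · norm_num at h
  · norm_num at h

theorem lt_neg_one_of_Rq_eq_neg_one {y : ℝ} (h : Rq y = -1) : y < -1 := by
  unfold Rq at h
  split_ifs at h with h1 h2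
  · norm_num at h
  · exact h2
  · norm_num at h

namespace Protocol

variable {n : ℕ} (P : Protocol n)

/-- The estimate of `j`'s value kept by the receiver `i` agrees with the one kept by the
sender `j`. -/
theorem xin_eq_xout (t : ℕ) (i j : Fin n) : P.xin t i j = P.xout t j i := by
  induction t with
  | zero => rw [P.hxin0, P.hxout0]
  | succ t ih =>
    by_cases h : P.E (t + 1) i j
    · rw [P.hxinE _ (by omega) _ _ h, P.hxoutE _ (by omega) _ _ (P.Esymm _ _ _ h)]
      simp only [Nat.add_sub_cancel, ih]
    · rw [P.hxinN _ (by omega) _ _ h,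
        P.hxoutN _ (by omega) _ _ (fun h' => h (P.Esymm _ _ _ h'))]
      simp only [Nat.add_sub_cancel, ih]

/-- When the message sent is `0`, the sender's value is within `1 / t ^ α` of its estimate. -/
theorem abs_sub_xout_le {t : ℕ} (ht : 1 ≤ t) {i j : Fin n} (hE : P.E t i j)
    (hq : P.q t i j = 0) : |P.x (t - 1) i - P.xout t i j| ≤ 1 / (t : ℝ) ^ P.α := by
  have hpos : 0 < (t : ℝ) ^ P.α := Real.rpow_pos_of_pos (by exact_mod_cast ht) _
  have hout := P.hxoutE t ht i j hE
  rw [hq, zero_div, add_zero] at hout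
  have h := abs_le_one_of_Rq_eq_zero ((P.hq t ht i j hE).symm.trans hq)
  rw [abs_mul, abs_of_pos hpos] at h
  rw [hout, le_div_iff₀ hpos, mul_comm]
  exact h

/-- The difference of estimates across an edge used in the update is at most twice the
distance from the node's value to the bounds of the current values. -/
theorem xin_sub_xout_mem_Icc {t : ℕ} (ht : 1 ≤ t) {m M : ℝ}
    (hm : ∀ k, m ≤ P.x (t - 1) k) (hM : ∀ k, P.x (t - 1) k ≤ M) {i j : Fin n}
    (hj : j ∈ P.S t i) :
    P.xin t i j - P.xout t i j ∈
      Set.Icc (-(2 * (P.x (t - 1) i - m))) (2 * (M - P.x (t - 1) i)) := by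
  obtain ⟨hE, hlt, hji, hij⟩ := (Finset.mem_filter.1 hj).2
  have h1 := abs_le.1 (P.abs_sub_xout_le ht hE hij)
  have h2 := abs_le.1 (P.abs_sub_xout_le ht (P.Esymm _ _ _ hE) hji)
  rw [← P.xin_eq_xout] at h2
  have hfour : 4 / (t : ℝ) ^ P.α = 4 * (1 / (t : ℝ) ^ P.α) := by ring
  rw [hfour] at hlt
  have := hm i
  have := hm j
  have := hM i
  have := hM j
  rcases lt_abs.1 hlt with h | h <;> constructor <;> linarith

theorem sum_div_le {t : ℕ} {i : Fin n} {a : Fin n → ℝ} {C : ℝ} (hC : 0 ≤ C)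
    (ha : ∀ j ∈ P.S t i, a j ≤ 2 * C) :
    ∑ j ∈ P.S t i, a j / (4 * P.D i j t) ≤ C / 2 := by
  rcases (P.S t i).eq_empty_or_nonempty with h | h
  · simp only [h, Finset.sum_empty]
    positivity
  have hcard : (0 : ℝ) < (P.S t i).card := by exact_mod_cast h.card_pos
  calc ∑ j ∈ P.S t i, a j / (4 * P.D i j t)
      ≤ ∑ _j ∈ P.S t i, 2 * C / (4 * (P.S t i).card) := by
        refine Finset.sum_le_sum fun j hj => ?_
        have hE : P.E t i j := (Finset.mem_filter.1 hj).2.1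
        have hle : (P.S t i).card ≤ Set.ncard {k | P.E t i k} := by
          rw [← Set.ncard_coe_finset]
          exact Set.ncard_le_ncard (fun k hk => (Finset.mem_filter.1 hk).2.1)
            (Set.toFinite _)
        have hD : ((P.S t i).card : ℝ) ≤ P.D i j t :=
          le_trans (by exact_mod_cast hle.trans (le_max_left _ _)) (P.Dbound t i j hE)
        have hDpos : 0 < P.D i j t := hcard.trans_le hD
        calc a j / (4 * P.D i j t) ≤ 2 * C / (4 * P.D i j t) := by
              gcongr
              exact ha j hj
          _ ≤ 2 * C / (4 * (P.S t i).card) := by gcongr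
    _ = C / 2 := by
        rw [Finset.sum_const, nsmul_eq_mul]
        field_simp
        ring

/-- A single update moves a node at most by `1 / (2 * t ^ β)` times its distance to the bounds
of the current values. -/
theorem x_sub_mem_Icc {t : ℕ} (ht : 1 ≤ t) {m M : ℝ}
    (hm : ∀ k, m ≤ P.x (t - 1) k) (hM : ∀ k, P.x (t - 1) k ≤ M) (i : Fin n) :
    P.x t i - P.x (t - 1) i ∈
      Set.Icc (-(1 / (t : ℝ) ^ P.β * ((P.x (t - 1) i - m) / 2)))
        (1 / (t : ℝ) ^ P.β * ((M - P.x (t - 1) i) / 2)) := by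
  have hx : P.x t i - P.x (t - 1) i = 1 / (t : ℝ) ^ P.β *
      ∑ j ∈ P.S t i, (P.xin t i j - P.xout t i j) / (4 * P.D i j t) := by
    rw [P.hx t ht i, add_sub_cancel_left, S]
  have hpos : 0 ≤ 1 / (t : ℝ) ^ P.β := by positivity
  have hup := P.sum_div_le (sub_nonneg.2 (hM i))
    fun j hj => (P.xin_sub_xout_mem_Icc ht hm hM hj).2
  have hlow := P.sum_div_le (t := t) (i := i)
    (a := fun j => -(P.xin t i j - P.xout t i j)) (sub_nonneg.2 (hm i))
    fun j hj => by linarith [(P.xin_sub_xout_mem_Icc ht hm hM hj).1]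
  simp only [neg_div, Finset.sum_neg_distrib] at hlow
  rw [hx]
  constructor
  · rw [← mul_neg]
    exact mul_le_mul_of_nonneg_left (by linarith) hpos
  · exact mul_le_mul_of_nonneg_left hup hpos

/-- Bounds on the initial values persist. -/
theorem x_mem_Icc {m M : ℝ} (h : ∀ k, P.x 0 k ∈ Set.Icc m M) (t : ℕ) (k : Fin n) :
    P.x t k ∈ Set.Icc m M := by
  induction t generalizing k with
  | zero => exact h k
  | succ t ih =>
    obtain ⟨hl, hu⟩ := P.x_sub_mem_Icc (t := t + 1) (by omega)
      (fun k => (ih k).1) (fun k => (ih k).2) k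
    simp only [Nat.add_sub_cancel] at hl hu
    obtain ⟨h1, h2⟩ := ih k
    have hone : 1 / ((t + 1 : ℕ) : ℝ) ^ P.β ≤ 1 := by
      have : 1 ≤ ((t + 1 : ℕ) : ℝ) ^ P.β :=
        Real.one_le_rpow (by simp) (P.hα.trans P.hαβ).le
      exact (div_le_one (by linarith)).2 this
    have hl' := mul_le_of_le_one_left
      (show 0 ≤ (P.x t k - m) / 2 by linarith) hone
    have hu' := mul_le_of_le_one_left
      (show 0 ≤ (M - P.x t k) / 2 by linarith) hone
    constructor <;> linarith

theorem x_zero_mem_Icc (k : Fin n) : P.x 0 k ∈ Set.Icc (minV (P.x 0)) (maxV (P.x 0)) :=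
  ⟨ciInf_le (Set.finite_range _).bddBelow k, le_ciSup (Set.finite_range _).bddAbove k⟩

theorem abs_x_sub_le {t : ℕ} (ht : 1 ≤ t) (i : Fin n) :
    |P.x t i - P.x (t - 1) i| ≤ 1 / (t : ℝ) ^ P.β * (Wsp (P.x 0) / 2) := by
  have hb := P.x_mem_Icc P.x_zero_mem_Icc (t - 1)
  obtain ⟨hl, hu⟩ := P.x_sub_mem_Icc ht (fun k => (hb k).1) (fun k => (hb k).2) i
  obtain ⟨h1, h2⟩ := hb i
  have hpos : 0 ≤ 1 / (t : ℝ) ^ P.β := by positivity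
  unfold Wsp
  rw [abs_le]
  constructor
  · refine le_trans (neg_le_neg (mul_le_mul_of_nonneg_left ?_ hpos)) hl
    linarith
  · refine hu.trans (mul_le_mul_of_nonneg_left ?_ hpos)
    linarith

end Protocol

theorem half_div_rpow_le {a b w s : ℝ} (ha : 0 < a) (hab : a < b) (hb : b < 1) (hw : 0 ≤ w)
    (hs : 1 ≤ s) (h : (8 * w) ^ (1 / (b - a)) ≤ s) :
    1 / s ^ b * (w / 2) ≤ (1 / 8) / (s + 1) ^ a := by
  have hs0 : 0 < s := by linarith
  have hba : 0 < b - a := sub_pos.2 hab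
  have h8 : 8 * w ≤ s ^ (b - a) := by
    rw [one_div] at h
    exact (Real.rpow_inv_le_iff_of_pos (by positivity) hs0.le hba).1 h
  have hsb : s ^ b = s ^ (b - a) * s ^ a := by
    rw [← Real.rpow_add hs0, sub_add_cancel]
  have hdouble : (s + 1) ^ a ≤ 2 * s ^ a := by
    calc (s + 1) ^ a ≤ (2 * s) ^ a := Real.rpow_le_rpow (by linarith) (by linarith) ha.le
      _ = 2 ^ a * s ^ a := Real.mul_rpow (by norm_num) hs0.le
      _ ≤ 2 * s ^ a := by
        gcongr
        exact Real.rpow_le_self_of_one_le (by norm_num) (by linarith)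
  have hsa : 0 < s ^ a := Real.rpow_pos_of_pos hs0 _
  have hsbpos : 0 < s ^ b := Real.rpow_pos_of_pos hs0 _
  have hta : 0 < (s + 1) ^ a := Real.rpow_pos_of_pos (by linarith) _
  have key : 4 * w * (s + 1) ^ a ≤ s ^ b := by
    calc 4 * w * (s + 1) ^ a ≤ 4 * w * (2 * s ^ a) := by gcongr
      _ = 8 * w * s ^ a := by ring
      _ ≤ s ^ b := by
        rw [hsb]
        gcongr
  rw [one_div_mul_eq_div, div_le_div_iff₀ hsbpos hta]
  linarith

/-- if `q_{j→i}(t) ∈ {-1,1}` at a late enough time then the estimation error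
across the edge decreases by `(7/8)/t^α`. -/
theorem stmt9_error_decrease {n : ℕ} (hn : 1 ≤ n) (P : Protocol n)
    (t : ℕ) (ht1 : 1 < t)
    (ht : 1 + (8 * Wsp (P.x 0)) ^ ((1 : ℝ) / (P.β - P.α)) ≤ (t : ℝ))
    (i j : Fin n) (hE : P.E t i j)
    (hq : P.q t j i = -1 ∨ P.q t j i = 1) :
    |P.xin t i j - P.x (t - 1) j| ≤
      |P.xin (t - 1) i j - P.x (t - 2) j| - (7 / 8) / (t : ℝ) ^ P.α := by
  obtain ⟨s, rfl⟩ : ∃ s, t = s + 1 := ⟨t - 1, by omega⟩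
  have hs : 1 ≤ s := by omega
  have hEji := P.Esymm _ _ _ hE
  have hpos : 0 < ((s + 1 : ℕ) : ℝ) ^ P.α := Real.rpow_pos_of_pos (by positivity) _
  have hmove : |P.x s j - P.x (s - 1) j| ≤ (1 / 8) / ((s + 1 : ℕ) : ℝ) ^ P.α := by
    have hW : 0 ≤ Wsp (P.x 0) :=
      sub_nonneg.2 ((P.x_zero_mem_Icc i).1.trans (P.x_zero_mem_Icc i).2)
    refine (P.abs_x_sub_le hs j).trans ?_
    push_cast at ht ⊢
    exact half_div_rpow_le P.hα P.hαβ P.hβ hW (by exact_mod_cast hs) (by linarith)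
  have hin := P.hxinE (s + 1) (by omega) i j hE
  have hR := P.hq (s + 1) (by omega) j i hEji
  rw [← P.xin_eq_xout] at hR
  rw [show s + 1 - 2 = s - 1 by omega]
  simp only [Nat.add_sub_cancel] at hin hR ⊢
  have h8 : (1 / 8) / ((s + 1 : ℕ) : ℝ) ^ P.α = 1 / 8 * (1 / ((s + 1 : ℕ) : ℝ) ^ P.α) := by ring
  have h78 : (7 / 8) / ((s + 1 : ℕ) : ℝ) ^ P.α = 7 / 8 * (1 / ((s + 1 : ℕ) : ℝ) ^ P.α) := by ring
  rw [h8] at hmove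
  rw [h78]
  obtain ⟨hm1, hm2⟩ := abs_le.1 hmove
  rcases hq with hq | hq
  · have h := lt_neg_one_of_Rq_eq_neg_one (hR.symm.trans hq)
    have hgap : 1 / ((s + 1 : ℕ) : ℝ) ^ P.α < P.xin s i j - P.x s j := by
      rw [div_lt_iff₀ hpos]
      linarith
    rw [hq, neg_div] at hin
    have := le_abs_self (P.xin s i j - P.x (s - 1) j)
    rw [hin, abs_of_nonneg (by linarith)]
    linarith
  · have h := one_lt_of_Rq_eq_one (hR.symm.trans hq)
    have hgap : 1 / ((s + 1 : ℕ) : ℝ) ^ P.α < P.x s j - P.xin s i j := by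
      rw [div_lt_iff₀ hpos]
      linarith
    rw [hq] at hin
    have := neg_le_abs (P.xin s i j - P.x (s - 1) j)
    rw [hin, abs_of_nonpos (by linarith)]
    linarith
end
end

section
/- Let c ∈ (0,1) and let d, e, f be positive reals. The function g(k) = e^{(1/d)(k+f)^c} / k^e is nondecreasing on the interval [t₀, +∞) for any positive real t₀ satisfying t₀ / (t₀ + f)^{1−c} ≥ d·e/c. -/
noncomputable section

theorem div_add_rpow_monotoneOn {a f : ℝ} (ha : a ≤ 1) (hf : 0 ≤ f) :
    MonotoneOn (fun k : ℝ => k / (k + f) ^ a) (Set.Ioi 0) := by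
  intro s hs t ht hst
  rw [Set.mem_Ioi] at hs ht
  have hsf : 0 < s + f := by linarith
  have htf : 0 < t + f := by linarith
  have h_ratio : (t + f) ^ a / (s + f) ^ a ≤ t / s := by
    rw [← Real.div_rpow htf.le hsf.le]
    calc ((t + f) / (s + f)) ^ a ≤ ((t + f) / (s + f)) ^ (1 : ℝ) :=
          Real.rpow_le_rpow_of_exponent_le ((one_le_div hsf).2 (by linarith)) ha
      _ = (t + f) / (s + f) := Real.rpow_one _
      _ ≤ t / s := by
          rw [div_le_div_iff₀ hsf hs]
          nlinarith
  have hsa := Real.rpow_pos_of_pos hsf a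
  have hta := Real.rpow_pos_of_pos htf a
  rw [div_le_div_iff₀ hsa hs] at h_ratio
  change s / (s + f) ^ a ≤ t / (t + f) ^ a
  rw [div_le_div_iff₀ hsa hta]
  linarith

theorem rpow_sub_log_monotoneOn {c d e f t₀ : ℝ} (hc : 0 < c)
    (hd : 0 < d) (hf : 0 < f) (ht₀ : 0 < t₀)
    (h : d * e / c ≤ t₀ / (t₀ + f) ^ (1 - c)) :
    MonotoneOn (fun k : ℝ => (1 / d) * (k + f) ^ c - e * Real.log k) (Set.Ici t₀) := by
  have h_deriv : ∀ k : ℝ, 0 < k →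
      HasDerivAt (fun k : ℝ => (1 / d) * (k + f) ^ c - e * Real.log k)
        ((1 / d) * (1 * c * (k + f) ^ (c - 1)) - e * k⁻¹) k := fun k hk =>
    ((((hasDerivAt_id k).add_const f).rpow_const (Or.inl (by simp; linarith))).const_mul
      (1 / d)).sub ((Real.hasDerivAt_log hk.ne').const_mul e)
  refine monotoneOn_of_deriv_nonneg (convex_Ici t₀)
    (fun k hk => (h_deriv k (ht₀.trans_le hk)).continuousAt.continuousWithinAt)
    (fun k hk => (h_deriv k (ht₀.trans_le
      (interior_subset hk))).differentiableAt.differentiableWithinAt) fun k hk => ?_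
  have hk₀ : t₀ ≤ k := interior_subset hk
  have hk_pos : 0 < k := ht₀.trans_le hk₀
  have hkf : 0 < k + f := by linarith
  have h_le : d * e / c ≤ k / (k + f) ^ (1 - c) :=
    h.trans (div_add_rpow_monotoneOn (by linarith) hf.le ht₀ hk_pos hk₀)
  rw [(h_deriv k hk_pos).deriv, show c - 1 = -(1 - c) by ring, Real.rpow_neg hkf.le]
  have hp := Real.rpow_pos_of_pos hkf (1 - c)
  rw [div_le_div_iff₀ hc hp] at h_le
  have h_eq : (1 / d) * (1 * c * ((k + f) ^ (1 - c))⁻¹) - e * k⁻¹ =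
      (k * c - d * e * (k + f) ^ (1 - c)) / (d * (k + f) ^ (1 - c) * k) := by
    field_simp
  rw [h_eq]
  exact div_nonneg (by linarith) (by positivity)

/-- for `c ∈ (0,1)` and positive `d, e, f`, the function
`g(k) = e^{(1/d)(k+f)^c} / k^e` is nondecreasing on `[t₀, ∞)` for any positive `t₀`
with `t₀ / (t₀ + f)^{1-c} ≥ d·e/c`. -/
theorem stmt14_g_monotone (c d e f t₀ : ℝ) (hc : 0 < c) (hc1 : c < 1)
    (hd : 0 < d) (he : 0 < e) (hf : 0 < f) (ht₀ : 0 < t₀)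
    (h : d * e / c ≤ t₀ / (t₀ + f) ^ (1 - c)) :
    MonotoneOn (fun k : ℝ => Real.exp ((1 / d) * (k + f) ^ c) / k ^ e)
      (Set.Ici t₀) := by
  have h_exp : ∀ k : ℝ, 0 < k → Real.exp ((1 / d) * (k + f) ^ c) / k ^ e =
      Real.exp ((1 / d) * (k + f) ^ c - e * Real.log k) := fun k hk => by
    rw [Real.exp_sub, Real.rpow_def_of_pos hk, mul_comm e]
  intro s hs t ht hst
  change Real.exp _ / s ^ e ≤ Real.exp _ / t ^ e
  rw [h_exp s (ht₀.trans_le hs), h_exp t (ht₀.trans_le ht)]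
  exact Real.exp_le_exp.2 (rpow_sub_log_monotoneOn hc hd hf ht₀ h hs ht hst)
end
end

section
/- Let A be a symmetric stochastic n×n real matrix (all entries nonnegative, each row summing to 1, A = Aᵀ) and let x ∈ ℝⁿ with mean x̄ = (1/n)Σ_j x_j. Then ‖Ax − x̄·1‖₂² = ‖x − x̄·1‖₂² − Σ_{k<l} (A²)_{kl} (x_k − x_l)², where 1 is the all-ones vector and (A²)_{kl} is the (k,l) entry of A². -/
noncomputable section

/-- A symmetric function vanishing on the diagonal sums to twice its sum over ordered pairs. -/
theorem sum_sum_eq_two_mul_sum_filter_lt {ι R : Type*} [Fintype ι] [LinearOrder ι]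
    [NonAssocSemiring R] (f : ι → ι → R) (hf : ∀ k l, f k l = f l k) (hdiag : ∀ k, f k k = 0) :
    ∑ k, ∑ l, f k l =
      2 * ∑ p ∈ Finset.univ.filter (fun p : ι × ι => p.1 < p.2), f p.1 p.2 := by
  have hsplit (k l : ι) :
      f k l = (if k < l then f k l else 0) + (if l < k then f l k else 0) := by
    rcases lt_trichotomy k l with h | rfl | h
    · simp [h, h.not_gt]
    · simp [hdiag]
    · simp [h, h.not_gt, hf k l]
  rw [Finset.sum_filter, Fintype.sum_prod_type, two_mul]
  conv_lhs => enter [2, k, 2, l]; rw [hsplit k l]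
  simp only [Finset.sum_add_distrib]
  congr 1
  exact Finset.sum_comm

/-- The Dirichlet form of a symmetric matrix whose rows sum to one. -/
theorem Matrix.IsSymm.sum_sum_mul_sub_sq {ι R : Type*} [Fintype ι] [CommRing R]
    {B : Matrix ι ι R} (hB : B.IsSymm) (hrow : ∀ i, ∑ j, B i j = 1) (y : ι → R) :
    ∑ k, ∑ l, B k l * (y k - y l) ^ 2 = 2 * (∑ k, y k ^ 2 - y ⬝ᵥ B.mulVec y) := by
  have hleft : ∑ k, ∑ l, B k l * y k ^ 2 = ∑ k, y k ^ 2 := by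
    simp only [← Finset.sum_mul, hrow, one_mul]
  have hright : ∑ k, ∑ l, B k l * y l ^ 2 = ∑ k, y k ^ 2 := by
    rw [Finset.sum_comm, ← hleft]
    simp only [hB.apply]
  have hmid : y ⬝ᵥ B.mulVec y = ∑ k, ∑ l, B k l * (y k * y l) := by
    simp only [dotProduct, Matrix.mulVec, Finset.mul_sum]
    exact Finset.sum_congr rfl fun k _ => Finset.sum_congr rfl fun l _ => by ring
  calc
    _ = ∑ k, ∑ l, (B k l * y k ^ 2 + B k l * y l ^ 2 - 2 * (B k l * (y k * y l))) :=
      Finset.sum_congr rfl fun k _ => Finset.sum_congr rfl fun l _ => by ring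
    _ = _ := by
      simp only [Finset.sum_sub_distrib, Finset.sum_add_distrib, ← Finset.mul_sum]
      rw [hleft, hright, hmid]
      ring

/-- for a symmetric stochastic matrix `A` and `x ∈ ℝⁿ` with mean `x̄`,
`‖Ax - x̄·1‖₂² = ‖x - x̄·1‖₂² - Σ_{k<l} (A²)_{kl} (x_k - x_l)²`, written via sums of
squares. -/
theorem stmt15_variance_decomposition {n : ℕ} (A : Matrix (Fin n) (Fin n) ℝ)
    (hsym : A.IsSymm) (hnn : ∀ i j, 0 ≤ A i j) (hrow : ∀ i, ∑ j, A i j = 1)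
    (x : Fin n → ℝ) :
    ∑ i, (A.mulVec x i - (∑ j, x j) / n) ^ 2 =
      ∑ i, (x i - (∑ j, x j) / n) ^ 2 -
        ∑ p ∈ Finset.univ.filter (fun p : Fin n × Fin n => p.1 < p.2),
          (A * A) p.1 p.2 * (x p.1 - x p.2) ^ 2 := by
  set c := (∑ j, x j) / (n : ℝ)
  have hrow_sq (i : Fin n) : ∑ j, (A * A) i j = 1 := by
    simp only [Matrix.mul_apply]
    rw [Finset.sum_comm]
    simp only [← Finset.mul_sum, hrow, mul_one]
  have hsymm_sq : (A * A).IsSymm := by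
    rw [Matrix.IsSymm, Matrix.transpose_mul, hsym.eq]
  let y : Fin n → ℝ := fun i => x i - c
  have hmulVec (i : Fin n) : A.mulVec x i - c = A.mulVec y i := by
    simp only [Matrix.mulVec, dotProduct, y, mul_sub, Finset.sum_sub_distrib, ← Finset.sum_mul,
      hrow, one_mul]
  have hnorm : ∑ i, A.mulVec y i ^ 2 = y ⬝ᵥ (A * A).mulVec y := by
    rw [← Matrix.mulVec_mulVec, Matrix.dotProduct_mulVec, ← Matrix.mulVec_transpose, hsym.eq]
    simp only [dotProduct, sq]
  have hdouble := sum_sum_eq_two_mul_sum_filter_lt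
    (fun k l => (A * A) k l * (x k - x l) ^ 2)
    (fun k l => by rw [hsymm_sq.apply l k, sub_sq_comm]) (fun k => by simp)
  have hdirichlet := hsymm_sq.sum_sum_mul_sub_sq hrow_sq y
  simp only [y, sub_sub_sub_cancel_right] at hdirichlet
  simp only [hmulVec, hnorm]
  linarith
end
end

section
/- Let B be a positive integer, α ∈ (0,1), and let Λ ⊆ {1, 2, 3, …} be a set of integers intersecting every block [kB+1, (k+1)B] for each integer k ≥ 0. Then for all integers a, b with a ≥ 4B and b − a ≥ 2B: Σ_{k ∈ Λ, a ≤ k ≤ b} k^{−α} ≥ (1/(6B)) · Σ_{k=a}^{b} k^{−α}. -/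
open scoped Classical

noncomputable section

/-- Halving the base of a power with exponent in `[-1, 0]` at most doubles it. -/
theorem rpow_neg_le_two_mul_rpow_neg {α x y : ℝ} (hα : 0 ≤ α) (hα1 : α ≤ 1) (hx : 0 ≤ x)
    (hy : 0 < y) (hyx : y ≤ 2 * x) : x ^ (-α) ≤ 2 * y ^ (-α) := by
  have h1 : (2 * x) ^ (-α) ≤ y ^ (-α) :=
    Real.rpow_le_rpow_of_nonpos hy hyx (by linarith)
  rw [Real.mul_rpow (by norm_num) hx] at h1
  have h2 : (2 : ℝ) ^ (-1 : ℝ) ≤ (2 : ℝ) ^ (-α) :=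
    Real.rpow_le_rpow_of_exponent_le (by norm_num) (by linarith)
  rw [Real.rpow_neg_one] at h2
  have h3 := mul_le_mul_of_nonneg_right h2 (Real.rpow_nonneg hx (-α))
  linarith

/-- If `Λ` meets every block `[jB+1,(j+1)B]` and `[a,b]` is long enough, then every `k ∈ [a,b]`
has an element of `Λ ∩ [a,b]` in its own block or in an adjacent one. -/
theorem exists_mem_adjacent_block {B : ℕ} (hB : 0 < B) {Λ : Set ℕ}
    (hblocks : ∀ k : ℕ, ∃ m ∈ Λ, k * B + 1 ≤ m ∧ m ≤ (k + 1) * B)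
    {a b k : ℕ} (ha : 4 * B ≤ a) (hab : a + 2 * B ≤ b) (hak : a ≤ k) (hkb : k ≤ b) :
    ∃ m ∈ Λ, a ≤ m ∧ m ≤ b ∧ m ≤ k + 2 * B ∧
      (m - 1) / B * B + 1 ≤ k + B ∧ k ≤ (m - 1) / B * B + 2 * B := by
  have key : ∀ j : ℕ, a ≤ j * B + 1 → j * B + B ≤ b → j * B + 1 ≤ k + B →
      k ≤ j * B + 2 * B → ∃ m ∈ Λ, a ≤ m ∧ m ≤ b ∧ m ≤ k + 2 * B ∧
      (m - 1) / B * B + 1 ≤ k + B ∧ k ≤ (m - 1) / B * B + 2 * B := by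
    intro j h1 h2 h3 h4
    obtain ⟨m, hm, hm1, hm2⟩ := hblocks j
    rw [Nat.succ_mul] at hm2
    have hj : (m - 1) / B = j :=
      Nat.div_eq_of_lt_le (by omega) (by rw [Nat.succ_mul]; omega)
    refine ⟨m, hm, by omega, by omega, by omega, ?_, ?_⟩ <;> rw [hj] <;> assumption
  obtain ⟨q, hq1, hq2⟩ : ∃ q, q * B + 1 ≤ k ∧ k ≤ q * B + B := by
    refine ⟨(k - 1) / B, ?_, ?_⟩
    · have := Nat.div_mul_le_self (k - 1) B
      omega
    · have := Nat.lt_div_mul_add (a := k - 1) hB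
      omega
  by_cases hlow : q * B + 1 < a
  · have := Nat.add_one_mul q B
    exact key (q + 1) (by omega) (by omega) (by omega) (by omega)
  by_cases hhigh : b < q * B + B
  · obtain _ | p := q
    · omega
    · have := Nat.add_one_mul p B
      exact key p (by omega) (by omega) (by omega) (by omega)
  · exact key q (by omega) (by omega) (by omega) (by omega)

/-- if `Λ` meets every block `[kB+1,(k+1)B]`, then for `a ≥ 4B` and
`b - a ≥ 2B`, the sum of `k^{-α}` over `Λ ∩ [a,b]` is at least `1/(6B)` times the full
sum over `[a,b]`. -/
theorem stmt17_block_sum_bound (B : ℕ) (hB : 0 < B) (α : ℝ) (hα : 0 < α) (hα1 : α < 1)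
    (Λ : Set ℕ) (hΛpos : ∀ k ∈ Λ, 1 ≤ k)
    (hblocks : ∀ k : ℕ, ∃ m ∈ Λ, k * B + 1 ≤ m ∧ m ≤ (k + 1) * B)
    (a b : ℕ) (ha : 4 * B ≤ a) (hab : a + 2 * B ≤ b) :
    (1 / (6 * (B : ℝ))) * ∑ k ∈ Finset.Icc a b, (k : ℝ) ^ (-α) ≤
      ∑ k ∈ (Finset.Icc a b).filter (· ∈ Λ), (k : ℝ) ^ (-α) := by
  have hex : ∀ k : ℕ, ∃ m : ℕ, k ∈ Finset.Icc a b → m ∈ Λ ∧ a ≤ m ∧ m ≤ b ∧ m ≤ k + 2 * B ∧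
      (m - 1) / B * B + 1 ≤ k + B ∧ k ≤ (m - 1) / B * B + 2 * B := by
    intro k
    by_cases hk : k ∈ Finset.Icc a b
    · obtain ⟨m, hm⟩ := exists_mem_adjacent_block hB hblocks ha hab
        (Finset.mem_Icc.mp hk).1 (Finset.mem_Icc.mp hk).2
      exact ⟨m, fun _ => hm⟩
    · exact ⟨0, fun h => absurd h hk⟩
  choose f hf using hex
  have hmaps : ∀ k ∈ Finset.Icc a b, f k ∈ (Finset.Icc a b).filter (· ∈ Λ) := by
    intro k hk
    obtain ⟨h1, h2, h3, -⟩ := hf k hk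
    exact Finset.mem_filter.mpr ⟨Finset.mem_Icc.mpr ⟨h2, h3⟩, h1⟩
  have hcard : ∀ m : ℕ, ((Finset.Icc a b).filter (f · = m)).card ≤ 3 * B := by
    intro m
    have hsub : (Finset.Icc a b).filter (f · = m) ⊆
        Finset.Icc ((m - 1) / B * B + 1 - B) ((m - 1) / B * B + 2 * B) := by
      intro k hk
      obtain ⟨hkab, rfl⟩ := Finset.mem_filter.mp hk
      obtain ⟨-, -, -, -, h1, h2⟩ := hf k hkab
      exact Finset.mem_Icc.mpr ⟨by omega, h2⟩
    refine (Finset.card_le_card hsub).trans ?_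
    rw [Nat.card_Icc]
    omega
  have hterm : ∀ k ∈ Finset.Icc a b, (k : ℝ) ^ (-α) ≤ 2 * (f k : ℝ) ^ (-α) := by
    intro k hk
    obtain ⟨h1, -, -, h2, -⟩ := hf k hk
    have hak := (Finset.mem_Icc.mp hk).1
    refine rpow_neg_le_two_mul_rpow_neg hα.le hα1.le k.cast_nonneg ?_ ?_
    · exact_mod_cast hΛpos _ h1
    · exact_mod_cast (by omega : f k ≤ 2 * k)
  have hmain : ∑ k ∈ Finset.Icc a b, (k : ℝ) ^ (-α) ≤
      6 * (B : ℝ) * ∑ m ∈ (Finset.Icc a b).filter (· ∈ Λ), (m : ℝ) ^ (-α) := by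
    refine (Finset.sum_le_sum hterm).trans ?_
    rw [← Finset.sum_fiberwise_of_maps_to hmaps, Finset.mul_sum]
    refine Finset.sum_le_sum fun m _ => ?_
    rw [Finset.sum_congr rfl (g := fun _ => 2 * (m : ℝ) ^ (-α))
      fun k hk => by rw [(Finset.mem_filter.mp hk).2], Finset.sum_const, nsmul_eq_mul]
    have hc : (((Finset.Icc a b).filter (f · = m)).card : ℝ) ≤ 3 * B := by
      exact_mod_cast hcard m
    have hm : (0 : ℝ) ≤ 2 * (m : ℝ) ^ (-α) := by positivity
    calc _ ≤ 3 * (B : ℝ) * (2 * (m : ℝ) ^ (-α)) := mul_le_mul_of_nonneg_right hc hm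
      _ = _ := by ring
  have hB' : (0 : ℝ) < 6 * B := by positivity
  rw [one_div, inv_mul_le_iff₀ hB']
  exact hmain
end
end
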